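/- Let f be a Ruelle-expanding map of a compact metric space. Then the number of fixed points of f^p satisfies N_p(f) = ∑_{r=1}^{L} (−1)^{r−1} tr((B^{(r)})^p) for all p ∈ ℕ, where the B^{(r)} are the signed transition matrices constructed from a Markov cover; consequently ζ_f(t) = ∏_{r even} det(I − t B^{(r)}) / ∏_{r odd} det(I − t B^{(r)}), a rational function. -/

import Mathlib

/-- A continuous map of a compact metric space is Ruelle-expanding with constants
`r`, `lam`, `c` if distinct points with the same image are at distance `> c`, and every
preimage of a point `x` extends to a contractive inverse branch on the ball `B_r(x)`. -/
def RuelleExpanding {K : Type*} [MetricSpace K] (f : K → K) (r lam c : ℝ) : Prop :=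
  0 < r ∧ 0 < lam ∧ lam < 1 ∧ 0 < c ∧
  (∀ x y : K, x ≠ y → f x = f y → c < dist x y) ∧
  (∀ x a : K, f a = x →
    ∃ φ : Metric.ball x r → K,
      (∀ hx : x ∈ Metric.ball x r, φ ⟨x, hx⟩ = a) ∧
      (∀ y : Metric.ball x r, f (φ y) = (y : K)) ∧
      (∀ y z : Metric.ball x r, dist (φ y) (φ z) ≤ lam * dist (y : K) (z : K)))



open Polynomial in
lemma RZ_det_aeval {n : Type*} [Fintype n] [DecidableEq n] (M : Matrix n n ℂ) (q : ℂ[X]) :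
    (aeval M q).det = (M.charpoly.roots.map (fun z => q.eval z)).prod := by
  have hcard : Multiset.card M.charpoly.roots = Fintype.card n := by
    rw [← M.charpoly_natDegree_eq_dim]
    exact ((IsAlgClosed.splits M.charpoly).natDegree_eq_card_roots).symm
  have hlin : ∀ a : ℂ, (M - algebraMap ℂ (Matrix n n ℂ) a).det
      = (M.charpoly.roots.map (fun z => z - a)).prod := by
    intro a
    have h1 : (M - algebraMap ℂ (Matrix n n ℂ) a).det
        = (-1) ^ Fintype.card n * M.charpoly.eval a := by
      rw [Matrix.eval_charpoly, ← Matrix.det_neg]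
      congr 1
      rw [neg_sub]
      rfl
    have h2 : M.charpoly.eval a = (M.charpoly.roots.map (fun z => a - z)).prod := by
      conv_lhs => rw [(IsAlgClosed.splits M.charpoly).eq_prod_roots_of_monic M.charpoly_monic]
      rw [eval_multiset_prod, Multiset.map_map]
      simp
    rw [h1, h2, ← hcard, ← Multiset.card_map (fun z => a - z), ← Multiset.prod_map_neg,
      Multiset.map_map]
    simp
  have hq : q ∈ Submonoid.closure ({x | ∃ a : ℂ, C a = x} ∪ {x | ∃ a : ℂ, X + C a = x}) :=
    IsAlgClosed.splits q
  induction hq using Submonoid.closure_induction with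
  | mem x hx =>
    rcases hx with ⟨a, rfl⟩ | ⟨a, rfl⟩
    · simp [hcard, Matrix.algebraMap_eq_diagonal]
    · have := hlin (-a)
      simpa using this
  | one => simp
  | mul x y _ _ hx hy => simp [hx, hy]

open Polynomial in
lemma RZ_trace_pow {n : Type*} [Fintype n] [DecidableEq n] (M : Matrix n n ℂ) (m : ℕ) :
    (M ^ m).trace = (M.charpoly.roots.map (fun z => z ^ m)).sum := by
  have h : (M ^ m).charpoly = ((M.charpoly.roots.map (fun z => z ^ m)).map (fun z => X - C z)).prod := by
    apply Polynomial.funext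
    intro a
    rw [Matrix.eval_charpoly, eval_multiset_prod, Multiset.map_map, Multiset.map_map]
    have := RZ_det_aeval M (C a - X ^ m)
    simp only [map_sub, aeval_C, map_pow, aeval_X] at this
    simpa [Matrix.algebraMap_eq_diagonal, Pi.algebraMap_def] using this
  rw [Matrix.trace_eq_sum_roots_charpoly, h, roots_multiset_prod_X_sub_C]

lemma RZ_zeta {n : Type*} [Fintype n] [DecidableEq n] (M : Matrix n n ℂ) :
    ∃ δ : ℝ, 0 < δ ∧ ∀ t : ℂ, ‖t‖ < δ →
      (1 - t • M).det ≠ 0 ∧ ∃ S : ℂ,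
        HasSum (fun m : ℕ => ((M ^ (m + 1)).trace / (m + 1)) * t ^ (m + 1)) S ∧
        Complex.exp S = ((1 - t • M).det)⁻¹ := by
  obtain ⟨C, hC⟩ : ∃ C : ℝ, ∀ z ∈ M.charpoly.roots, ‖z‖ ≤ C := by
    obtain ⟨C, hC⟩ := ((M.charpoly.roots.toFinset.image (fun z => ‖z‖)).finite_toSet).bddAbove
    refine ⟨C, fun z hz => hC ?_⟩
    simp only [Finset.coe_image, Set.mem_image, Finset.mem_coe, Multiset.mem_toFinset]
    exact ⟨z, hz, rfl⟩
  refine ⟨1 / (|C| + 1), by positivity, fun t ht => ?_⟩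
  have hsmall : ∀ z ∈ M.charpoly.roots, ‖z * t‖ < 1 := by
    intro z hz
    rw [norm_mul]
    have h1 : ‖z‖ ≤ |C| := (hC z hz).trans (le_abs_self C)
    have h2 : ‖t‖ * (|C| + 1) < 1 := by
      rwa [lt_div_iff₀ (by positivity)] at ht
    nlinarith [norm_nonneg t, norm_nonneg z]
  have hdet : (1 - t • M).det = (M.charpoly.roots.map (fun z => 1 - z * t)).prod := by
    have := RZ_det_aeval M (1 - Polynomial.C t * Polynomial.X)
    simp only [map_sub, map_one, map_mul, Polynomial.aeval_C, Polynomial.aeval_X,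
      ← Algebra.smul_def] at this
    rw [this]
    congr 1
    refine Multiset.map_congr rfl fun z _ => ?_
    simp only [Polynomial.eval_sub, Polynomial.eval_one, Polynomial.eval_mul, Polynomial.eval_C,
      Polynomial.eval_X]
    rw [mul_comm]
  have key : ∀ s : Multiset ℂ, (∀ z ∈ s, ‖z * t‖ < 1) →
      (s.map (fun z => 1 - z * t)).prod ≠ 0 ∧ ∃ S : ℂ,
        HasSum (fun m : ℕ => ((s.map (fun z => z ^ (m + 1))).sum / (m + 1)) * t ^ (m + 1)) S ∧
        Complex.exp S = ((s.map (fun z => 1 - z * t)).prod)⁻¹ := by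
    intro s
    induction s using Multiset.induction_on with
    | empty => intro _; exact ⟨by simp, 0, by simp, by simp⟩
    | cons a s ih =>
      intro hs
      obtain ⟨h1, S, h2, h3⟩ := ih (fun z hz => hs z (Multiset.mem_cons_of_mem hz))
      have ha := hs a (Multiset.mem_cons_self a s)
      have hne : 1 - a * t ≠ 0 := by
        intro h0
        rw [sub_eq_zero] at h0
        rw [← h0] at ha
        simp at ha
      refine ⟨by simp [h1, hne], -Complex.log (1 - a * t) + S, ?_, ?_⟩
      · convert! (Complex.hasSum_taylorSeries_neg_log' ha).add h2 using 2 with m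
        simp only [Multiset.map_cons, Multiset.sum_cons]
        ring
      · rw [Complex.exp_add, Complex.exp_neg, Complex.exp_log hne, h3]
        simp [mul_comm]
  have := key _ hsmall
  simp only [← RZ_trace_pow, ← hdet] at this
  exact this

/-- Product `M 0 * M 1 * ... * M n`. -/
def RZ_prod {ι : Type*} [Fintype ι] (M : ℕ → Matrix ι ι ℤ) : ℕ → Matrix ι ι ℤ
  | 0 => M 0
  | n + 1 => M 0 * RZ_prod (fun m => M (m + 1)) n

lemma RZ_prod_const {ι : Type*} [Fintype ι] [DecidableEq ι] (M : Matrix ι ι ℤ) (n : ℕ) :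
    RZ_prod (fun _ => M) n = M ^ (n + 1) := by
  induction n with
  | zero => simp [RZ_prod]
  | succ n ih => rw [RZ_prod, ih, pow_succ' M (n + 1)]

lemma RZ_prod_apply {ι : Type*} [Fintype ι] (n : ℕ) :
    ∀ (M : ℕ → Matrix ι ι ℤ) (i j : ι), RZ_prod M n i j
      = ∑ w : Fin n → ι, ∏ m : Fin (n + 1), M m ((Fin.cons i w : Fin (n + 1) → ι) m)
          ((Fin.snoc w j : Fin (n + 1) → ι) m) := by
  induction n with
  | zero =>
    intro M i j
    simp [RZ_prod, Fin.snoc]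
  | succ n ih =>
    intro M i j
    rw [RZ_prod, Matrix.mul_apply]
    rw [← (Fin.consEquiv (fun _ : Fin (n + 1) => ι)).sum_comp, Fintype.sum_prod_type]
    refine Finset.sum_congr rfl fun u _ => ?_
    rw [ih, Finset.mul_sum]
    refine Finset.sum_congr rfl fun w _ => ?_
    rw [Fin.prod_univ_succ (n := n + 1)]
    simp only [Fin.consEquiv, Equiv.coe_fn_mk, ← Fin.cons_snoc_eq_snoc_cons, Fin.cons_zero,
      Fin.cons_succ, Fin.val_zero, Fin.val_succ]

lemma RZ_trace_prod {ι : Type*} [Fintype ι] (M : ℕ → Matrix ι ι ℤ) (n : ℕ) :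
    (RZ_prod M n).trace = ∑ v : Fin (n + 1) → ι, ∏ m : Fin (n + 1), M m (v m) (v (m + 1)) := by
  rw [Matrix.trace, ← (Fin.consEquiv (fun _ : Fin (n + 1) => ι)).sum_comp, Fintype.sum_prod_type]
  refine Finset.sum_congr rfl fun i _ => ?_
  rw [Matrix.diag_apply, RZ_prod_apply]
  refine Finset.sum_congr rfl fun w _ => ?_
  refine Finset.prod_congr rfl fun m _ => ?_
  simp only [Fin.consEquiv, Equiv.coe_fn_mk]
  congr 1
  cases m using Fin.lastCases with
  | last => simp
  | cast j => simp

/-- The compound matrix of (the matrix of) a function `g`. -/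
noncomputable def RZ_P {k : ℕ} (ρ : ℕ) (g : Fin k → Fin k) :
    Matrix (Finset (Fin k)) (Finset (Fin k)) ℤ := fun s t =>
  if h : s.card = ρ ∧ t.card = ρ then
    (Matrix.of fun a b : Fin ρ =>
      if s.orderEmbOfFin h.1 a = g (t.orderEmbOfFin h.2 b) then (1 : ℤ) else 0).det
  else 0

lemma RZ_P_eq {k : ℕ} (ρ : ℕ) (g : Fin k → Fin k) (s t : Finset (Fin k)) (hs : s.card = ρ)
    (ht : t.card = ρ) : RZ_P ρ g s t = (Matrix.of fun a b : Fin ρ =>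
      if s.orderEmbOfFin hs a = g (t.orderEmbOfFin ht b) then (1 : ℤ) else 0).det := by
  rw [RZ_P, dif_pos ⟨hs, ht⟩]

lemma RZ_P_ne {k : ℕ} {ρ : ℕ} {g : Fin k → Fin k} {s t : Finset (Fin k)}
    (h : RZ_P ρ g s t ≠ 0) : s.card = ρ ∧ t.card = ρ ∧ Set.InjOn g t ∧ t.image g = s := by
  by_cases hc : s.card = ρ ∧ t.card = ρ
  · obtain ⟨hs, ht⟩ := hc
    rw [RZ_P_eq ρ g s t hs ht] at h
    have hinj : Set.InjOn g t := by
      intro x hx y hy hxy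
      by_contra hne
      apply h
      have hx' : x ∈ Set.range (t.orderEmbOfFin ht) := by simpa using hx
      have hy' : y ∈ Set.range (t.orderEmbOfFin ht) := by simpa using hy
      obtain ⟨a, rfl⟩ := hx'
      obtain ⟨b, rfl⟩ := hy'
      refine Matrix.det_zero_of_column_eq (i := a) (j := b) (fun hab => hne (by rw [hab])) ?_
      intro c
      simp [hxy]
    refine ⟨hs, ht, hinj, ?_⟩
    refine Finset.eq_of_subset_of_card_le ?_ ?_
    · intro y hy
      obtain ⟨x, hx, rfl⟩ := Finset.mem_image.1 hy
      by_contra hne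
      apply h
      have hx' : x ∈ Set.range (t.orderEmbOfFin ht) := by simpa using hx
      obtain ⟨b, rfl⟩ := hx'
      refine Matrix.det_eq_zero_of_column_eq_zero b fun a => ?_
      simp only [Matrix.of_apply]
      rw [if_neg]
      intro h'
      apply hne
      rw [← h']
      exact Finset.orderEmbOfFin_mem s hs a
    · rw [Finset.card_image_of_injOn hinj, hs, ht]
  · rw [RZ_P, dif_neg hc] at h
    exact absurd rfl h

lemma RZ_P_mul {k : ℕ} (ρ : ℕ) (g h : Fin k → Fin k) :
    RZ_P ρ g * RZ_P ρ h = RZ_P ρ (g ∘ h) := by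
  ext s t
  rw [Matrix.mul_apply]
  by_cases hc : s.card = ρ ∧ t.card = ρ
  swap
  · have : RZ_P ρ (g ∘ h) s t = 0 := by rw [RZ_P, dif_neg hc]
    rw [this]
    refine Finset.sum_eq_zero fun u _ => ?_
    by_contra hne
    exact hc ⟨(RZ_P_ne (left_ne_zero_of_mul hne)).1, (RZ_P_ne (right_ne_zero_of_mul hne)).2.1⟩
  obtain ⟨hs, ht⟩ := hc
  by_cases hinj : Set.InjOn h t
  · have hu : (t.image h).card = ρ := by rw [Finset.card_image_of_injOn hinj, ht]
    rw [Finset.sum_eq_single (t.image h)]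
    · rw [RZ_P_eq ρ g _ _ hs hu, RZ_P_eq ρ h _ _ hu ht, RZ_P_eq ρ _ _ _ hs ht, ← Matrix.det_mul]
      congr 1
      ext a b
      simp only [Matrix.mul_apply, Matrix.of_apply, Function.comp]
      have hb : h (t.orderEmbOfFin ht b) ∈ Set.range ((t.image h).orderEmbOfFin hu) := by
        rw [Finset.range_orderEmbOfFin]
        exact Finset.mem_coe.2 (Finset.mem_image_of_mem _ (Finset.orderEmbOfFin_mem t ht b))
      obtain ⟨c, hc⟩ := hb
      rw [Finset.sum_eq_single c]
      · simp [hc]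
      · intro d _ hd
        have hne : ¬ ((t.image h).orderEmbOfFin hu d = h (t.orderEmbOfFin ht b)) := fun h' =>
          hd (((t.image h).orderEmbOfFin hu).injective (h'.trans hc.symm))
        simp [hne]
      · simp
    · intro u _ hu'
      by_contra hne
      exact hu' (RZ_P_ne (right_ne_zero_of_mul hne)).2.2.2.symm
    · simp
  · have h0 : RZ_P ρ (g ∘ h) s t = 0 := by
      by_contra hne
      apply hinj
      intro x hx y hy hxy
      exact (RZ_P_ne hne).2.2.1 hx hy (by simp [hxy])
    rw [h0]
    refine Finset.sum_eq_zero fun u _ => ?_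
    by_contra hne
    exact hinj (RZ_P_ne (right_ne_zero_of_mul hne)).2.2.1

/-- Composite `g 0 ∘ g 1 ∘ ... ∘ g n`. -/
def RZ_comp {k : ℕ} (g : ℕ → Fin k → Fin k) : ℕ → Fin k → Fin k
  | 0 => g 0
  | n + 1 => g 0 ∘ RZ_comp (fun m => g (m + 1)) n

lemma RZ_prod_P {k : ℕ} (ρ : ℕ) (n : ℕ) : ∀ (g : ℕ → Fin k → Fin k),
    RZ_prod (fun m => RZ_P ρ (g m)) n = RZ_P ρ (RZ_comp g n) := by
  induction n with
  | zero => intro g; rfl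
  | succ n ih =>
    intro g
    rw [RZ_prod, ih (fun m => g (m + 1)), RZ_P_mul]
    rfl

lemma RZ_comp_mem {k : ℕ} (g : ℕ → Fin k → Fin k) (T : Set (Fin k)) (h : ∀ j, g 0 j ∈ T)
    (n : ℕ) (j : Fin k) : RZ_comp g n j ∈ T := by
  cases n with
  | zero => exact h j
  | succ n => exact h _

open Polynomial in
lemma RZ_alt_trace {k : ℕ} (G : Fin k → Fin k) (L : ℕ) (i₀ : Fin k) (T : Set (Fin k))
    (hG : ∀ j, G j ∈ T)
    (hT : ∀ s : Finset (Fin k), s.Nonempty → (∀ i ∈ s, i ∈ T) → s.card ≤ L) :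
    ∑ ρ ∈ Finset.Icc 1 L, (-1) ^ (ρ - 1) * (RZ_P ρ G).trace = 1 := by
  set N : Matrix (Fin k) (Fin k) ℤ := Matrix.of fun i j => if i = G j then 1 else 0 with hN
  have htr : ∀ ρ, (RZ_P ρ G).trace = (Matrix.det (1 + (X : ℤ[X]) • N.map C)).coeff ρ := by
    intro ρ
    rw [Matrix.coeff_det_one_add_X_smul_eq_sum_minors, Matrix.trace]
    rw [← Finset.sum_subset (Finset.subset_univ (Finset.univ.powersetCard ρ))]
    · refine Finset.sum_congr rfl fun s hs => ?_
      have hs' : s.card = ρ := (Finset.mem_powersetCard.1 hs).2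
      rw [Matrix.diag_apply, RZ_P_eq ρ G s s hs' hs',
        ← Matrix.det_submatrix_equiv_self (s.orderIsoOfFin hs').toEquiv]
      rfl
    · intro s _ hs
      by_contra hne
      exact hs (Finset.mem_powersetCard.2 ⟨Finset.subset_univ s, (RZ_P_ne hne).1⟩)
  set D := Matrix.det (1 + (X : ℤ[X]) • N.map C) with hD
  have hdeg : D.natDegree ≤ L := by
    rw [natDegree_le_iff_coeff_eq_zero]
    intro ρ hρ
    rw [← htr, Matrix.trace]
    refine Finset.sum_eq_zero fun s _ => ?_
    by_contra hne
    obtain ⟨h1, _, _, h4⟩ := RZ_P_ne hne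
    have hne' : s.Nonempty := by
      rw [← Finset.card_pos]; omega
    have := hT s hne' (fun i hi => by
      rw [← h4] at hi
      obtain ⟨j, _, rfl⟩ := Finset.mem_image.1 hi
      exact hG j)
    omega
  have h0 : D.coeff 0 = 1 := by
    rw [hD, Matrix.coeff_det_one_add_X_smul_eq_sum_minors]
    simp
  have hev : D.eval (-1) = 0 := by
    have h1 : D.eval (-1) = (1 - N).det := by
      rw [hD, ← coe_evalRingHom, RingHom.map_det]
      congr 1
      ext i j
      by_cases hij : i = j <;> simp [sub_eq_add_neg, hij]
    rw [h1, ← Matrix.exists_vecMul_eq_zero_iff]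
    refine ⟨fun _ => 1, fun h => by simpa using congrFun h i₀, ?_⟩
    ext j
    simp [Matrix.vecMul, dotProduct, hN, Matrix.one_apply]
  rw [eval_eq_sum_range' (Nat.lt_succ_of_le hdeg), Finset.sum_range_succ', h0] at hev
  rw [← Finset.sum_bij (i := fun (m : ℕ) (_ : m ∈ Finset.range L) => m + 1)
    (f := fun m => (-1) ^ m * D.coeff (m + 1))]
  · have : ∑ m ∈ Finset.range L, D.coeff (m + 1) * (-1) ^ (m + 1)
      = - ∑ m ∈ Finset.range L, (-1) ^ m * D.coeff (m + 1) := by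
      rw [← Finset.sum_neg_distrib]
      refine Finset.sum_congr rfl fun m _ => by ring
    rw [this] at hev
    linarith
  · intro a ha; simp at ha ⊢; omega
  · intro a _ b _ h; omega
  · intro b hb
    simp at hb
    exact ⟨b - 1, by simp; omega, by omega⟩
  · intro a _
    simp [htr]

/-- The transition relation. -/
def RZ_A {K : Type*} [MetricSpace K] (f : K → K) {k : ℕ} (R : Fin k → Set K) (i j : Fin k) :
    Prop := (f '' interior (R i) ∩ interior (R j)).Nonempty

lemma RZ_inj {K : Type*} [MetricSpace K] [CompactSpace K] (f : K → K) (c : ℝ)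
    (hc : ∀ x y : K, x ≠ y → f x = f y → c < dist x y)
    {k : ℕ} (R : Fin k → Set K) (hdiam : ∀ i, Metric.diam (R i) < c / 2)
    {a b : Fin k} {x y : K} (hx : x ∈ R a) (hy : y ∈ R b) (hab : (R a ∩ R b).Nonempty)
    (hxy : f x = f y) : x = y := by
  by_contra hne
  obtain ⟨z, hza, hzb⟩ := hab
  have h1 := hc x y hne hxy
  have h2 : dist x z ≤ Metric.diam (R a) :=
    Metric.dist_le_diam_of_mem (isCompact_univ.isBounded.subset (Set.subset_univ _)) hx hza
  have h3 : dist z y ≤ Metric.diam (R b) :=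
    Metric.dist_le_diam_of_mem (isCompact_univ.isBounded.subset (Set.subset_univ _)) hzb hy
  have h4 := dist_triangle x z y
  have h5 := hdiam a
  have h6 := hdiam b
  linarith

lemma RZ_unique {K : Type*} [MetricSpace K] [CompactSpace K] (f : K → K) (c : ℝ)
    (hc : ∀ x y : K, x ≠ y → f x = f y → c < dist x y)
    {k : ℕ} (R : Fin k → Set K) (hdiam : ∀ i, Metric.diam (R i) < c / 2)
    (hdisj : ∀ i j, i ≠ j → interior (R i) ∩ interior (R j) = ∅)
    (hmarkov : ∀ i j, (f '' interior (R i) ∩ interior (R j)).Nonempty →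
      interior (R j) ⊆ f '' interior (R i))
    {i i' j : Fin k} (h : RZ_A f R i j) (h' : RZ_A f R i' j) (hii : (R i ∩ R i').Nonempty) :
    i = i' := by
  by_contra hne
  obtain ⟨w, _, hw⟩ := id h
  obtain ⟨u, hu, hu'⟩ := hmarkov i j h hw
  obtain ⟨v, hv, hv'⟩ := hmarkov i' j h' hw
  have huv : u = v := RZ_inj f c hc R hdiam (interior_subset hu) (interior_subset hv) hii
    (hu'.trans hv'.symm)
  subst huv
  have : u ∈ interior (R i) ∩ interior (R i') := ⟨hu, hv⟩
  rw [hdisj i i' hne] at this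
  exact this

lemma RZ_cover {K : Type*} [MetricSpace K] [CompactSpace K] (f : K → K) (hf : Continuous f)
    {k : ℕ} (R : Fin k → Set K)
    (hproper : ∀ i, closure (interior (R i)) = R i)
    (hmarkov : ∀ i j, (f '' interior (R i) ∩ interior (R j)).Nonempty →
      interior (R j) ⊆ f '' interior (R i))
    {i j : Fin k} (h : RZ_A f R i j) : R j ⊆ f '' R i := by
  have hcl : IsClosed (R i) := by rw [← hproper i]; exact isClosed_closure
  have hcl' : IsClosed (f '' R i) := (hcl.isCompact.image hf).isClosed
  rw [← hproper j]
  exact closure_minimal ((hmarkov i j h).trans (Set.image_mono interior_subset)) hcl'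

lemma RZ_exists {K : Type*} [MetricSpace K] [CompactSpace K] (f : K → K) (hf : Continuous f)
    (r lam c : ℝ) (hR : RuelleExpanding f r lam c)
    {k : ℕ} (R : Fin k → Set K)
    (hcover : ⋃ i, R i = Set.univ)
    (hproper : ∀ i, closure (interior (R i)) = R i)
    {y : K} {j : Fin k} (h : f y ∈ R j) : ∃ i, y ∈ R i ∧ RZ_A f R i j := by
  obtain ⟨hr, hl0, hl1, _, _, hbr⟩ := hR
  have hcl : ∀ i, IsClosed (R i) := fun i => by rw [← hproper i]; exact isClosed_closure
  obtain ⟨δ, hδ, hball⟩ : ∃ δ > 0, ∀ z ∈ Metric.ball y δ, ∀ i, z ∈ R i → y ∈ R i := by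
    have : ∀ᶠ z in nhds y, ∀ i, z ∈ R i → y ∈ R i := by
      rw [Filter.eventually_all]
      intro i
      by_cases hy : y ∈ R i
      · exact Filter.Eventually.of_forall fun _ _ => hy
      · filter_upwards [(hcl i).isOpen_compl.mem_nhds hy] with z hz hz'
        exact absurd hz' hz
    obtain ⟨δ, hδ, hh⟩ := Metric.eventually_nhds_iff_ball.1 this
    exact ⟨δ, hδ, hh⟩
  obtain ⟨φ, hφ1, hφ2, hφ3⟩ := hbr (f y) y rfl
  have hmem : f y ∈ closure (interior (R j)) := by rw [hproper]; exact h
  obtain ⟨w, hw, hwd⟩ := Metric.mem_closure_iff.1 hmem (min r δ) (lt_min hr hδ)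
  have hwr : w ∈ Metric.ball (f y) r := by
    rw [Metric.mem_ball, dist_comm]; exact hwd.trans_le (min_le_left _ _)
  have hyr : f y ∈ Metric.ball (f y) r := Metric.mem_ball_self hr
  have hv := hφ3 ⟨w, hwr⟩ ⟨f y, hyr⟩
  rw [hφ1 hyr] at hv
  have hU : IsOpen (f ⁻¹' interior (R j) ∩ Metric.ball y δ) :=
    (isOpen_interior.preimage hf).inter Metric.isOpen_ball
  have hvU : φ ⟨w, hwr⟩ ∈ f ⁻¹' interior (R j) ∩ Metric.ball y δ := by
    refine ⟨?_, ?_⟩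
    · change f (φ ⟨w, hwr⟩) ∈ interior (R j)
      rw [hφ2]; exact hw
    · rw [Metric.mem_ball]
      have h1 : dist w (f y) < δ := by rw [dist_comm]; exact hwd.trans_le (min_le_right _ _)
      have h2 : 0 ≤ dist w (f y) := dist_nonneg
      have h3 : dist (φ ⟨w, hwr⟩) y ≤ lam * dist w (f y) := hv
      nlinarith
  obtain ⟨i, hi⟩ := Set.mem_iUnion.1 (hcover.symm ▸ Set.mem_univ (φ ⟨w, hwr⟩) :
    φ ⟨w, hwr⟩ ∈ ⋃ i, R i)
  rw [← hproper i] at hi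
  obtain ⟨v, ⟨hv1, hv2⟩, hv3⟩ := mem_closure_iff.1 hi _ hU hvU
  exact ⟨i, hball v hv2 i (interior_subset hv3), f v, ⟨v, hv3, rfl⟩, hv1⟩

lemma RZ_chain {K : Type*} [MetricSpace K] [CompactSpace K] (f : K → K) (hf : Continuous f) (c : ℝ)
    (hc : ∀ x y : K, x ≠ y → f x = f y → c < dist x y)
    {k : ℕ} (R : Fin k → Set K) (hdiam : ∀ i, Metric.diam (R i) < c / 2)
    (hproper : ∀ i, closure (interior (R i)) = R i)
    (hmarkov : ∀ i j, (f '' interior (R i) ∩ interior (R j)).Nonempty →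
      interior (R j) ⊆ f '' interior (R i))
    (s : ℕ → Finset (Fin k)) (hs : ∀ m, (s m).Nonempty)
    (hI : ∀ m, (⋂ i ∈ s m, R i).Nonempty)
    (he : ∀ m, ∃ e : {i // i ∈ s m} ≃ {j // j ∈ s (m + 1)}, ∀ i, RZ_A f R i.1 (e i).1) :
    ∃ x, ∀ m, ∀ i ∈ s m, f^[m] x ∈ R i := by
  have hcl : ∀ i, IsClosed (R i) := fun i => by rw [← hproper i]; exact isClosed_closure
  have hpull : ∀ m, ∀ z ∈ ⋂ i ∈ s (m + 1), R i, ∃ u ∈ ⋂ i ∈ s m, R i, f u = z := by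
    intro m z hz
    obtain ⟨e, he⟩ := he m
    simp only [Set.mem_iInter] at hz
    have hpre : ∀ i : {i // i ∈ s m}, ∃ u ∈ R i.1, f u = z := fun i =>
      RZ_cover f hf R hproper hmarkov (he i) (hz _ (e i).2)
    obtain ⟨i₀, hi₀⟩ := hs m
    obtain ⟨u, hu, huz⟩ := hpre ⟨i₀, hi₀⟩
    refine ⟨u, ?_, huz⟩
    simp only [Set.mem_iInter]
    intro i hi
    obtain ⟨u', hu', huz'⟩ := hpre ⟨i, hi⟩
    obtain ⟨q, hq⟩ := hI m
    simp only [Set.mem_iInter] at hq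
    have : u = u' := RZ_inj f c hc R hdiam hu hu' ⟨q, hq i₀ hi₀, hq i hi⟩ (huz.trans huz'.symm)
    rw [this]; exact hu'
  have hfin : ∀ n a, ∃ x, ∀ m ≤ n, ∀ i ∈ s (a + m), f^[m] x ∈ R i := by
    intro n
    induction n with
    | zero =>
      intro a
      obtain ⟨q, hq⟩ := hI a
      simp only [Set.mem_iInter] at hq
      refine ⟨q, fun m hm i hi => ?_⟩
      obtain rfl : m = 0 := by omega
      exact hq i hi
    | succ n ih =>
      intro a
      obtain ⟨x, hx⟩ := ih (a + 1)
      have hx0 : x ∈ ⋂ i ∈ s (a + 1), R i := by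
        simp only [Set.mem_iInter]
        exact fun i hi => hx 0 (Nat.zero_le _) i hi
      obtain ⟨u, hu, hux⟩ := hpull a x hx0
      simp only [Set.mem_iInter] at hu
      refine ⟨u, fun m hm i hi => ?_⟩
      cases m with
      | zero => exact hu i hi
      | succ m =>
        rw [Function.iterate_succ_apply, hux]
        refine hx m (by omega) i ?_
        rwa [show a + 1 + m = a + (m + 1) by omega]
  have hC : (⋂ n : ℕ, {x | ∀ m ≤ n, ∀ i ∈ s m, f^[m] x ∈ R i}).Nonempty := by
    have hclosed : ∀ n : ℕ, IsClosed {x | ∀ m ≤ n, ∀ i ∈ s m, f^[m] x ∈ R i} := by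
      intro n
      simp only [Set.ofPred_forall]
      exact isClosed_iInter fun m => isClosed_iInter fun _ => isClosed_iInter fun i =>
        isClosed_iInter fun _ => (hcl i).preimage (hf.iterate m)
    refine IsCompact.nonempty_iInter_of_sequence_nonempty_isCompact_isClosed _ ?_ ?_ ?_ hclosed
    · intro n x hx m hm
      exact hx m (by omega)
    · intro n
      obtain ⟨x, hx⟩ := hfin n 0
      refine ⟨x, fun m hm i hi => hx m hm i (by simpa using hi)⟩
    · exact (hclosed 0).isCompact
  obtain ⟨x, hx⟩ := hC
  rw [Set.mem_iInter] at hx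
  exact ⟨x, fun m i hi => hx m m le_rfl i hi⟩

lemma RZ_local {K : Type*} [MetricSpace K] [CompactSpace K] (f : K → K) (c : ℝ)
    (hc : ∀ x y : K, x ≠ y → f x = f y → c < dist x y)
    {k : ℕ} (R : Fin k → Set K) (hdiam : ∀ i, Metric.diam (R i) < c / 2)
    (hdisj : ∀ i j, i ≠ j → interior (R i) ∩ interior (R j) = ∅)
    (hmarkov : ∀ i j, (f '' interior (R i) ∩ interior (R j)).Nonempty →
      interior (R j) ⊆ f '' interior (R i))
    (B : ℕ → Matrix (Finset (Fin k)) (Finset (Fin k)) ℤ)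
    (hB0 : ∀ (ρ : ℕ) (s t : Finset (Fin k)),
      ¬ (s.card = ρ ∧ t.card = ρ ∧ (⋂ i ∈ s, R i).Nonempty ∧ (⋂ i ∈ t, R i).Nonempty ∧
        ∃! e : {i // i ∈ s} ≃ {j // j ∈ t},
          ∀ i : {i // i ∈ s},
            (f '' interior (R i.1) ∩ interior (R (e i).1)).Nonempty) →
      B ρ s t = 0)
    (hB1 : ∀ (ρ : ℕ) (s t : Finset (Fin k)) (hs : s.card = ρ) (ht : t.card = ρ),
      (⋂ i ∈ s, R i).Nonempty → (⋂ i ∈ t, R i).Nonempty →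
      ∀ e : {i // i ∈ s} ≃ {j // j ∈ t},
        (∀ i : {i // i ∈ s},
          (f '' interior (R i.1) ∩ interior (R (e i).1)).Nonempty) →
        (∀ e' : {i // i ∈ s} ≃ {j // j ∈ t},
          (∀ i : {i // i ∈ s},
            (f '' interior (R i.1) ∩ interior (R (e' i).1)).Nonempty) → e' = e) →
        B ρ s t = (Equiv.Perm.sign
          (((s.orderIsoOfFin hs).toEquiv.trans e).trans
            (t.orderIsoOfFin ht).toEquiv.symm) : ℤ))
    (y : K) (g : Fin k → Fin k) (hg : ∀ j, y ∈ R (g j))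
    (hg' : ∀ j, f y ∈ R j → RZ_A f R (g j) j)
    (ρ : ℕ) (s t : Finset (Fin k)) (hsy : ∀ i ∈ s, y ∈ R i) (hty : ∀ i ∈ t, f y ∈ R i) :
    RZ_P ρ g s t = B ρ s t := by
  by_cases hcard : s.card = ρ ∧ t.card = ρ
  swap
  · rw [hB0 ρ s t (fun h => hcard ⟨h.1, h.2.1⟩), RZ_P, dif_neg hcard]
  obtain ⟨hs, ht⟩ := hcard
  have hsI : (⋂ i ∈ s, R i).Nonempty := ⟨y, by simpa using hsy⟩
  have htI : (⋂ i ∈ t, R i).Nonempty := ⟨f y, by simpa using hty⟩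
  by_cases hex : ∃ e : {i // i ∈ s} ≃ {j // j ∈ t}, ∀ i, RZ_A f R i.1 (e i).1
  · obtain ⟨e, he⟩ := hex
    have hge : ∀ e : {i // i ∈ s} ≃ {j // j ∈ t}, (∀ i, RZ_A f R i.1 (e i).1) →
        ∀ i, g (e i).1 = i.1 := fun e he i =>
      RZ_unique f c hc R hdiam hdisj hmarkov (hg' _ (hty _ (e i).2)) (he i)
        ⟨y, hg _, hsy _ i.2⟩
    have hsymm : ∀ e : {i // i ∈ s} ≃ {j // j ∈ t}, (∀ i, RZ_A f R i.1 (e i).1) →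
        ∀ j, (e.symm j).1 = g j.1 := fun e he j => by
      have := hge e he (e.symm j)
      rw [Equiv.apply_symm_apply] at this
      exact this.symm
    rw [hB1 ρ s t hs ht hsI htI e he, RZ_P_eq ρ g s t hs ht]
    · have hd := Matrix.det_permutation (R := ℤ)
        (((s.orderIsoOfFin hs).toEquiv.trans e).trans (t.orderIsoOfFin ht).toEquiv.symm)
      rw [Int.cast_id] at hd
      rw [← hd]
      congr 1
      ext a b
      rw [Matrix.of_apply, Equiv.Perm.permMatrix, PEquiv.toMatrix_apply]
      have : s.orderEmbOfFin hs a = g (t.orderEmbOfFin ht b) ↔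
          (((s.orderIsoOfFin hs).toEquiv.trans e).trans (t.orderIsoOfFin ht).toEquiv.symm) a = b := by
        rw [Equiv.trans_apply, Equiv.symm_apply_eq, Equiv.trans_apply]
        rw [← Equiv.eq_symm_apply, Subtype.ext_iff, hsymm e he]
        rfl
      simp only [this]
      simp [Equiv.toPEquiv_apply, eq_comm]
    · intro e' he'
      rw [← Equiv.symm_symm e', ← Equiv.symm_symm e]
      congr 1
      ext j
      rw [hsymm e he, hsymm e' he']
  · rw [hB0 ρ s t (fun h => hex (by obtain ⟨e, he, _⟩ := h.2.2.2.2; exact ⟨e, he⟩))]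
    by_contra hne
    obtain ⟨_, _, hinj, himg⟩ := RZ_P_ne hne
    apply hex
    have hmem : ∀ j : {j // j ∈ t}, g j.1 ∈ s := fun j => by
      rw [← himg]; exact Finset.mem_image_of_mem _ j.2
    have hbij : Function.Bijective (fun j : {j // j ∈ t} => (⟨g j.1, hmem j⟩ : {i // i ∈ s})) := by
      constructor
      · intro a b hab
        exact Subtype.ext (hinj a.2 b.2 (Subtype.ext_iff.1 hab))
      · rintro ⟨i, hi⟩
        have hi' := hi
        rw [← himg] at hi'
        obtain ⟨j, hj, rfl⟩ := Finset.mem_image.1 hi'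
        exact ⟨⟨j, hj⟩, rfl⟩
    refine ⟨(Equiv.ofBijective _ hbij).symm, ?_⟩
    intro i
    obtain ⟨j, rfl⟩ := (Equiv.ofBijective _ hbij).surjective i
    rw [Equiv.symm_apply_apply]
    exact hg' _ (hty _ j.2)

/-- Rationality of the zeta function for Ruelle-expanding maps: with a Markov cover
`{R_1, …, R_k}`, transition relation `A_{ij} = 1 ↔ f(int R_i) ∩ int R_j ≠ ∅`, the sets
`I_r = {s ⊆ [k] : |s| = r, ⋂_{i ∈ s} R_i ≠ ∅}` and the signed matrices `B⁽ʳ⁾` (with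
`B⁽ʳ⁾_{st} = sgn μ` when `μ` is the unique permutation matching `s` to `t` along `A`, and
`0` otherwise, extended by `0` outside `I_r × I_r`), the number of fixed points of `f^p`
is `N_p(f) = ∑_{r=1}^L (-1)^{r-1} tr ((B⁽ʳ⁾)^p)`, and consequently
`ζ_f(t) = ∏_{r even} det (I - t B⁽ʳ⁾) / ∏_{r odd} det (I - t B⁽ʳ⁾)` is rational. -/
theorem ruelle_expanding_zeta_rational {K : Type*} [MetricSpace K] [CompactSpace K]
    (f : K → K) (hf : Continuous f) (r lam c : ℝ)
    (hR : RuelleExpanding f r lam c)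
    (ε : ℝ) (hε : 0 < ε)
    (hexp : ∀ x y : K, (∀ n : ℕ, dist (f^[n] x) (f^[n] y) ≤ ε) → x = y)
    (k : ℕ) (R : Fin k → Set K)
    (hcover : ⋃ i, R i = Set.univ)
    (hproper : ∀ i, closure (interior (R i)) = R i)
    (hdiam : ∀ i, Metric.diam (R i) < min ε (c / 2))
    (hdisj : ∀ i j, i ≠ j → interior (R i) ∩ interior (R j) = ∅)
    (hmarkov : ∀ i j, (f '' interior (R i) ∩ interior (R j)).Nonempty →
      interior (R j) ⊆ f '' interior (R i))
    (L : ℕ)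
    (hL1 : ∃ s : Finset (Fin k), s.card = L ∧ (⋂ i ∈ s, R i).Nonempty ∧ s.Nonempty)
    (hL2 : ∀ s : Finset (Fin k), s.Nonempty → (⋂ i ∈ s, R i).Nonempty → s.card ≤ L)
    (B : ℕ → Matrix (Finset (Fin k)) (Finset (Fin k)) ℤ)
    (hB0 : ∀ (ρ : ℕ) (s t : Finset (Fin k)),
      ¬ (s.card = ρ ∧ t.card = ρ ∧ (⋂ i ∈ s, R i).Nonempty ∧ (⋂ i ∈ t, R i).Nonempty ∧
        ∃! e : {i // i ∈ s} ≃ {j // j ∈ t},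
          ∀ i : {i // i ∈ s},
            (f '' interior (R i.1) ∩ interior (R (e i).1)).Nonempty) →
      B ρ s t = 0)
    (hB1 : ∀ (ρ : ℕ) (s t : Finset (Fin k)) (hs : s.card = ρ) (ht : t.card = ρ),
      (⋂ i ∈ s, R i).Nonempty → (⋂ i ∈ t, R i).Nonempty →
      ∀ e : {i // i ∈ s} ≃ {j // j ∈ t},
        (∀ i : {i // i ∈ s},
          (f '' interior (R i.1) ∩ interior (R (e i).1)).Nonempty) →
        (∀ e' : {i // i ∈ s} ≃ {j // j ∈ t},
          (∀ i : {i // i ∈ s},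
            (f '' interior (R i.1) ∩ interior (R (e' i).1)).Nonempty) → e' = e) →
        B ρ s t = (Equiv.Perm.sign
          (((s.orderIsoOfFin hs).toEquiv.trans e).trans
            (t.orderIsoOfFin ht).toEquiv.symm) : ℤ)) :
    (∀ p : ℕ, 0 < p →
      (Nat.card {x : K | f^[p] x = x} : ℤ)
        = ∑ ρ ∈ Finset.Icc 1 L, (-1) ^ (ρ - 1) * ((B ρ ^ p).trace)) ∧
    ∃ δ : ℝ, 0 < δ ∧ ∀ t : ℂ, ‖t‖ < δ →
      Complex.exp (∑' n : ℕ,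
          ((Nat.card {x : K | f^[n + 1] x = x} : ℂ) / (n + 1)) * t ^ (n + 1))
        = (∏ ρ ∈ (Finset.Icc 1 L).filter (fun ρ => Even ρ),
            (1 - t • (B ρ).map (Int.cast : ℤ → ℂ)).det)
          / ∏ ρ ∈ (Finset.Icc 1 L).filter (fun ρ => Odd ρ),
            (1 - t • (B ρ).map (Int.cast : ℤ → ℂ)).det := by
  obtain ⟨hr, hl0, hl1, hc0, hc, hbr⟩ := id hR
  have hdε : ∀ i, Metric.diam (R i) < ε := fun i => (hdiam i).trans_le (min_le_left _ _)
  have hdc : ∀ i, Metric.diam (R i) < c / 2 := fun i => (hdiam i).trans_le (min_le_right _ _)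
  -- two points following the same itinerary are equal
  have hsame : ∀ x y : K, (∀ N : ℕ, ∃ i, f^[N] x ∈ R i ∧ f^[N] y ∈ R i) → x = y := by
    intro x y h
    refine hexp x y fun N => ?_
    obtain ⟨i, h1, h2⟩ := h N
    exact (Metric.dist_le_diam_of_mem (isCompact_univ.isBounded.subset (Set.subset_univ _))
      h1 h2).trans (hdε i).le
  have hcov : ∀ y : K, ∃ i, y ∈ R i := fun y =>
    Set.mem_iUnion.1 (hcover.symm ▸ Set.mem_univ y : y ∈ ⋃ i, R i)
  have hgex : ∀ (y : K) (j : Fin k), ∃ i, y ∈ R i ∧ (f y ∈ R j → RZ_A f R i j) := by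
    intro y j
    by_cases h : f y ∈ R j
    · obtain ⟨i, h1, h2⟩ := RZ_exists f hf r lam c hR R hcover hproper h
      exact ⟨i, h1, fun _ => h2⟩
    · obtain ⟨i, hi⟩ := hcov y
      exact ⟨i, hi, fun h' => absurd h' h⟩
  choose g hg hg' using hgex
  have hcount : ∀ p : ℕ, 0 < p →
      (Nat.card {x : K | f^[p] x = x} : ℤ)
        = ∑ ρ ∈ Finset.Icc 1 L, (-1) ^ (ρ - 1) * ((B ρ ^ p).trace) := by
    intro p hp
    obtain ⟨n, rfl⟩ : ∃ n, p = n + 1 := ⟨p - 1, by omega⟩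
    have hmod : ∀ x, f^[n + 1] x = x → ∀ N, f^[N] x = f^[N % (n + 1)] x := fun x hx N =>
      (Function.IsPeriodicPt.iterate_mod_apply (f := f) hx N).symm
    have hfin : {x : K | f^[n + 1] x = x}.Finite := by
      refine Set.Finite.of_finite_image
        (f := fun x => fun m : Fin (n + 1) => {i : Fin k | f^[m] x ∈ R i}) (Set.toFinite _) ?_
      intro x hx y hy hxy
      refine hsame x y fun N => ?_
      rw [hmod x hx, hmod y hy]
      obtain ⟨i, hi⟩ := hcov (f^[N % (n + 1)] x)
      refine ⟨i, hi, ?_⟩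
      have h1 := congrFun hxy ⟨N % (n + 1), Nat.mod_lt _ hp⟩
      have h2 : i ∈ {i : Fin k | f^[N % (n + 1)] x ∈ R i} := hi
      have h3 : i ∈ {i : Fin k | f^[N % (n + 1)] y ∈ R i} := by
        rw [← show {i : Fin k | f^[N % (n + 1)] x ∈ R i} = {i : Fin k | f^[N % (n + 1)] y ∈ R i}
          from h1]
        exact h2
      exact h3
    set F := hfin.toFinset with hF
    have hFmem : ∀ x, x ∈ F ↔ f^[n + 1] x = x := fun x => by simp [hF]
    have hcs : ∀ N : ℕ, Fin.ofNat (n + 1) (N + 1) = Fin.ofNat (n + 1) N + 1 := fun N => by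
      apply Fin.ext
      simp [Fin.val_add, Fin.ofNat]
    have hcv : ∀ m : Fin (n + 1), Fin.ofNat (n + 1) (m : ℕ) = m := fun m => by
      apply Fin.ext
      simp [Fin.ofNat, Nat.mod_eq_of_lt m.2]
    have hterm : ∀ ρ ∈ Finset.Icc 1 L, ∀ v : Fin (n + 1) → Finset (Fin k),
        ∏ m : Fin (n + 1), B ρ (v m) (v (m + 1))
          = ∑ x ∈ F, ∏ m : Fin (n + 1), RZ_P ρ (g (f^[m] x)) (v m) (v (m + 1)) := by
      intro ρ hρ v
      have hρ1 : 1 ≤ ρ := (Finset.mem_Icc.1 hρ).1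
      -- a nonzero local weight forces following
      have ha : ∀ x ∈ F, ∏ m : Fin (n + 1), RZ_P ρ (g (f^[m] x)) (v m) (v (m + 1)) ≠ 0 →
          (∀ m, (v m).Nonempty) ∧ ∀ N : ℕ, ∀ i ∈ v (Fin.ofNat (n + 1) N), f^[N] x ∈ R i := by
        intro x hx hne
        rw [Finset.prod_ne_zero_iff] at hne
        refine ⟨fun m => ?_, fun N i hi => ?_⟩
        · rw [← Finset.card_pos, (RZ_P_ne (hne m (Finset.mem_univ m))).1]
          exact hρ1
        · rw [hmod x ((hFmem x).1 hx) N]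
          have h4 := (RZ_P_ne (hne (Fin.ofNat (n + 1) N) (Finset.mem_univ _))).2.2.2
          rw [← h4] at hi
          obtain ⟨j, _, rfl⟩ := Finset.mem_image.1 hi
          exact hg _ _
      by_cases hex : (∀ m, (v m).Nonempty) ∧
          ∃ x ∈ F, ∀ N : ℕ, ∀ i ∈ v (Fin.ofNat (n + 1) N), f^[N] x ∈ R i
      · obtain ⟨hvne, x, hx, hfol⟩ := hex
        rw [Finset.sum_eq_single x]
        · refine Finset.prod_congr rfl fun m _ => ?_
          symm
          refine RZ_local f c hc R hdc hdisj hmarkov B hB0 hB1 _ _ (hg _) (hg' _) ρ _ _ ?_ ?_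
          · intro i hi
            refine hfol m i ?_
            rwa [hcv]
          · intro i hi
            rw [← Function.iterate_succ_apply' f]
            refine hfol (m + 1) i ?_
            rwa [hcs, hcv]
        · intro y hy hyx
          by_contra hne
          obtain ⟨_, hfol'⟩ := ha y hy hne
          apply hyx
          refine hsame y x fun N => ?_
          obtain ⟨i, hi⟩ := hvne (Fin.ofNat (n + 1) N)
          exact ⟨i, hfol' N i hi, hfol N i hi⟩
        · exact fun h => absurd hx h
      · rw [Finset.sum_eq_zero]
        swap
        · intro x hx
          by_contra hne
          obtain ⟨h1, h2⟩ := ha x hx hne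
          exact hex ⟨h1, x, hx, h2⟩
        by_contra hne
        rw [← ne_eq, Finset.prod_ne_zero_iff] at hne
        have hB : ∀ m : Fin (n + 1), (v m).card = ρ ∧ (⋂ i ∈ v m, R i).Nonempty ∧
            ∃ e : {i // i ∈ v m} ≃ {j // j ∈ v (m + 1)}, ∀ i, RZ_A f R i.1 (e i).1 := by
          intro m
          by_contra hcon
          refine hne m (Finset.mem_univ m) (hB0 _ _ _ fun h => hcon ?_)
          obtain ⟨h1, _, h3, _, e, he, _⟩ := h
          exact ⟨h1, h3, e, he⟩
        have hvne : ∀ m, (v m).Nonempty := fun m => by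
          rw [← Finset.card_pos, (hB m).1]; exact hρ1
        obtain ⟨x, hx⟩ := RZ_chain f hf c hc R hdc hproper hmarkov
          (fun N => v (Fin.ofNat (n + 1) N)) (fun N => hvne _) (fun N => (hB _).2.1)
          (fun N => by
            have := (hB (Fin.ofNat (n + 1) N)).2.2
            rw [hcs]
            exact this)
        refine hex ⟨hvne, x, ?_, hx⟩
        rw [hFmem]
        refine hsame _ _ fun N => ?_
        obtain ⟨i, hi⟩ := hvne (Fin.ofNat (n + 1) N)
        refine ⟨i, ?_, hx N i hi⟩
        rw [← Function.iterate_add_apply]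
        refine hx (N + (n + 1)) i ?_
        have : Fin.ofNat (n + 1) (N + (n + 1)) = (Fin.ofNat (n + 1) N) := by
          apply Fin.ext
          simp [Fin.ofNat]
        rw [this]
        exact hi
    have hcardF : (Nat.card {x : K | f^[n + 1] x = x} : ℤ) = ∑ x ∈ F, 1 := by
      rw [Finset.sum_const, Nat.card_eq_card_finite_toFinset hfin]
      simp [hF]
    rw [hcardF]
    have hone : ∀ x ∈ F, (1 : ℤ) = ∑ ρ ∈ Finset.Icc 1 L, (-1) ^ (ρ - 1) *
        ∑ v : Fin (n + 1) → Finset (Fin k),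
          ∏ m : Fin (n + 1), RZ_P ρ (g (f^[m] x)) (v m) (v (m + 1)) := by
      intro x hx
      obtain ⟨i₀, hi₀⟩ := hcov x
      have := RZ_alt_trace (RZ_comp (fun m => g (f^[m] x)) n) L i₀ {i | x ∈ R i}
        (RZ_comp_mem _ _ (fun j => hg x j) n)
        (fun s hs hsT => hL2 s hs ⟨x, by simpa using hsT⟩)
      refine this.symm.trans ?_
      refine Finset.sum_congr rfl fun ρ _ => ?_
      rw [← RZ_prod_P, RZ_trace_prod]
    rw [Finset.sum_congr rfl hone, Finset.sum_comm]
    refine Finset.sum_congr rfl fun ρ hρ => ?_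
    rw [← Finset.mul_sum, Finset.sum_comm, ← RZ_prod_const, RZ_trace_prod]
    congr 1
    refine Finset.sum_congr rfl fun v _ => ?_
    exact (hterm ρ hρ v).symm
  refine ⟨hcount, ?_⟩
  set M : ℕ → Matrix (Finset (Fin k)) (Finset (Fin k)) ℂ :=
    fun ρ => (B ρ).map (Int.cast : ℤ → ℂ) with hM
  have hcountC : ∀ n : ℕ, (Nat.card {x : K | f^[n + 1] x = x} : ℂ)
      = ∑ ρ ∈ Finset.Icc 1 L, (-1) ^ (ρ - 1) * ((M ρ ^ (n + 1)).trace) := by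
    intro n
    have h := congrArg (Int.cast : ℤ → ℂ) (hcount (n + 1) (Nat.succ_pos n))
    push_cast at h
    rw [h]
    refine Finset.sum_congr rfl fun ρ _ => ?_
    congr 1
    have h1 : M ρ ^ (n + 1) = (B ρ ^ (n + 1)).map (Int.cast : ℤ → ℂ) := by
      rw [hM]
      exact (Matrix.map_pow (B ρ) (Int.castRingHom ℂ) (n + 1)).symm
    rw [h1]
    simp [Matrix.trace]
  choose δ hδ hδ' using fun ρ => RZ_zeta (M ρ)
  obtain ⟨d, hd, hdle⟩ : ∃ d : ℝ, 0 < d ∧ ∀ ρ ∈ Finset.Icc 1 L, d ≤ δ ρ := by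
    rcases (Finset.Icc 1 L).eq_empty_or_nonempty with h | h
    · exact ⟨1, one_pos, by simp [h]⟩
    · exact ⟨(Finset.Icc 1 L).inf' h δ, (Finset.lt_inf'_iff h).2 fun ρ _ => hδ ρ,
        fun ρ hρ => Finset.inf'_le δ hρ⟩
  refine ⟨d, hd, fun t ht => ?_⟩
  have hz : ∀ ρ ∈ Finset.Icc 1 L, (1 - t • M ρ).det ≠ 0 ∧ ∃ S : ℂ,
      HasSum (fun m : ℕ => ((M ρ ^ (m + 1)).trace / (m + 1)) * t ^ (m + 1)) S ∧
      Complex.exp S = ((1 - t • M ρ).det)⁻¹ := fun ρ hρ => hδ' ρ t (ht.trans_le (hdle ρ hρ))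
  choose! hne S hS hSexp using hz
  have hsum : HasSum (fun n : ℕ =>
      ((Nat.card {x : K | f^[n + 1] x = x} : ℂ) / (n + 1)) * t ^ (n + 1))
      (∑ ρ ∈ Finset.Icc 1 L, (-1) ^ (ρ - 1) * S ρ) := by
    have h := hasSum_sum (fun ρ hρ => (hS ρ hρ).mul_left ((-1 : ℂ) ^ (ρ - 1)))
    convert! h using 2 with n
    rw [hcountC, Finset.sum_div, Finset.sum_mul]
    refine Finset.sum_congr rfl fun ρ _ => by ring
  rw [hsum.tsum_eq, Complex.exp_sum]
  rw [← Finset.prod_filter_mul_prod_filter_not (Finset.Icc 1 L) (fun ρ => Even ρ), div_eq_mul_inv]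
  congr 1
  · refine Finset.prod_congr rfl fun ρ hρ => ?_
    obtain ⟨h1, h2⟩ := Finset.mem_filter.1 hρ
    have h3 : Odd (ρ - 1) := by
      have := (Finset.mem_Icc.1 h1).1
      exact Nat.Even.sub_odd this h2 odd_one
    rw [h3.neg_one_pow, neg_one_mul, Complex.exp_neg, hSexp ρ h1, inv_inv]
  · rw [← Finset.prod_inv_distrib]
    simp only [Nat.not_even_iff_odd]
    refine Finset.prod_congr rfl fun ρ hρ => ?_
    obtain ⟨h1, h2⟩ := Finset.mem_filter.1 hρ
    have h3 : Even (ρ - 1) := Nat.Odd.sub_odd h2 odd_one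
    rw [h3.neg_one_pow, one_mul, hSexp ρ h1]
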